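/- arXiv:1906.04502 — 2 statements merged into one kernel-verified Lean document; each statement's English description precedes it below -/
import Mathlib

section
/- Let γ = 1/4 and R_SSM(α) = α(α(α(2α-5) + 4) - (α-1)³/4)/((α-1)α² + 1). For every α with 0 < α ≤ 1/2, R_SSM(α) > α if and only if α > 1/3. In particular, at γ = 1/4 semi-selfish mining becomes profitable exactly at the threshold 1/3. -/
/-- Relative revenue of a single SSM miner with hash power α at propagation γ = 1/4. -/
noncomputable def R_SSM (α : ℝ) : ℝ :=
  α * (α * (α * (2 * α - 5) + 4) - (α - 1) ^ 3 / 4) / ((α - 1) * α ^ 2 + 1)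

theorem ssm_threshold_gamma_quarter (α : ℝ) (hα0 : 0 < α) (hα : α ≤ 1 / 2) :
    R_SSM α > α ↔ α > 1 / 3 := by
  have hden : 0 < (α - 1) * α ^ 2 + 1 := by nlinarith [pow_pos hα0 3]
  have hfactor : α * (α * (α * (2 * α - 5) + 4) - (α - 1) ^ 3 / 4)
      - α * ((α - 1) * α ^ 2 + 1) = α * (1 - α) * (3 - α) / 4 * (3 * α - 1) := by
    ring
  have hcoef : 0 < α * (1 - α) * (3 - α) / 4 :=
    div_pos (mul_pos (mul_pos hα0 (by linarith)) (by linarith)) (by norm_num)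
  rw [gt_iff_lt, R_SSM, lt_div_iff₀ hden, ← sub_pos, hfactor, mul_pos_iff_of_pos_left hcoef]
  constructor <;> intro h <;> linarith
end

section
/- Let γ = 1/4 and R_SM(α) = (α(1-α)²(4α + (1-2α)/4) - α³)/(1 - α(1 + (2-α)α)). For every α with 0 < α ≤ 1/2, R_SM(α) > α if and only if α > 3/10. In particular, at γ = 1/4 selfish mining becomes profitable exactly at the threshold 0.3. -/
/-- Eyal–Sirer relative revenue of a single selfish miner with hash power α at
propagation γ = 1/4. -/
noncomputable def R_SM (α : ℝ) : ℝ :=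
  (α * (1 - α) ^ 2 * (4 * α + (1 - 2 * α) / 4) - α ^ 3) /
    (1 - α * (1 + (2 - α) * α))

theorem sm_threshold_gamma_quarter (α : ℝ) (hα0 : 0 < α) (hα : α ≤ 1 / 2) :
    R_SM α > α ↔ α > 3 / 10 := by
  have hden : 0 < 1 - α * (1 + (2 - α) * α) := by
    nlinarith [pow_pos hα0 3, mul_nonneg hα0.le (sub_nonneg.2 hα)]
  have hfactor : α * (1 - α) ^ 2 * (4 * α + (1 - 2 * α) / 4) - α ^ 3 -
      α * (1 - α * (1 + (2 - α) * α)) = α * (1 - α) ^ 2 * (5 / 2) * (α - 3 / 10) := by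
    ring
  have hcoef : 0 < α * (1 - α) ^ 2 * (5 / 2) := by
    have : 0 < 1 - α := by linarith
    positivity
  rw [gt_iff_lt, gt_iff_lt, R_SM, lt_div_iff₀ hden, ← sub_pos, hfactor,
    mul_pos_iff_of_pos_left hcoef, sub_pos]
end
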